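/- Let T be a tournament on n ≥ 5 vertices. Then either δ_T = 0, or n - 3 ≤ δ_T ≤ (2/5)·C(n,4), where δ_T is the number of diamonds in T. -/

import Mathlib

open scoped Classical

/-- A tournament: irreflexive, and between distinct vertices exactly one arc. -/
def IsTournament {V : Type*} (r : V → V → Prop) : Prop :=
  (∀ i, ¬ r i i) ∧ ∀ i j, i ≠ j → (r i j ↔ ¬ r j i)

/-- Skew-adjacency matrix of a relation. -/
noncomputable def skew {V : Type*} (r : V → V → Prop) : Matrix V V ℤ :=
  Matrix.of fun i j => if r i j then 1 else if r j i then -1 else 0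

/-- Determinant of the skew-adjacency matrix. -/
noncomputable def tdet {V : Type*} [Fintype V] [DecidableEq V] (r : V → V → Prop) : ℤ :=
  (skew r).det

/-- Determinant of the subtournament induced by a finite vertex subset. -/
noncomputable def subdet {V : Type*} [Fintype V] [DecidableEq V] (r : V → V → Prop)
    (s : Finset V) : ℤ :=
  ((skew r).submatrix (fun x : {x // x ∈ s} => x.1) (fun x : {x // x ∈ s} => x.1)).det

/-- Switch of `r` with respect to `W`: arcs between `W` and its complement are reversed. -/
def switchRel {V : Type*} (r : V → V → Prop) (W : Set V) : V → V → Prop :=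
  fun i j => if (i ∈ W ↔ j ∈ W) then r i j else r j i

/-- Switching equivalence of two tournaments on the same vertex set. -/
def SwitchEquiv {V : Type*} (r₁ r₂ : V → V → Prop) : Prop :=
  ∃ W : Set V, ∀ i j, r₂ i j ↔ switchRel r₁ W i j

def IsTransitive {V : Type*} (r : V → V → Prop) : Prop :=
  ∀ a b c, r a b → r b c → r a c

def IsTransitiveOn {V : Type*} (r : V → V → Prop) (X : Finset V) : Prop :=
  ∀ a ∈ X, ∀ b ∈ X, ∀ c ∈ X, r a b → r b c → r a c

/-- A 4-set inducing a diamond: a vertex dominating or dominated by a 3-cycle. -/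
def IsDiamond {V : Type*} (r : V → V → Prop) (X : Finset V) : Prop :=
  ∃ a b c d : V, X = {a, b, c, d} ∧ a ≠ b ∧ a ≠ c ∧ a ≠ d ∧ b ≠ c ∧ b ≠ d ∧ c ≠ d ∧
    r b c ∧ r c d ∧ r d b ∧ ((r a b ∧ r a c ∧ r a d) ∨ (r b a ∧ r c a ∧ r d a))

/-- Number of diamonds of a tournament. -/
noncomputable def numDiamonds {V : Type*} [Fintype V] (r : V → V → Prop) : ℕ :=
  Set.ncard {X : Finset V | IsDiamond r X}

/-- The tournament `L_n`: a transitive chain `u_0 → ⋯ → u_{n-2}` together with a last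
vertex alternating along the chain, starting with `u_{n-1} → u_0`. -/
def LRel (n : ℕ) : Fin n → Fin n → Prop := fun i j =>
  (j.val < n - 1 ∧ i.val < j.val) ∨
  (j.val = n - 1 ∧ i.val < n - 1 ∧ i.val % 2 = 1) ∨
  (i.val = n - 1 ∧ j.val < n - 1 ∧ j.val % 2 = 0)

/-- Join of two tournaments: all arcs from the first to the second. -/
def joinRel {A B : Type*} (r : A → A → Prop) (s : B → B → Prop) : A ⊕ B → A ⊕ B → Prop :=
  fun x y => match x, y with
  | .inl a, .inl a' => r a a'
  | .inr b, .inr b' => s b b'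
  | .inl _, .inr _ => True
  | .inr _, .inl _ => False

/-- `T⁺`: add one new vertex dominated by every vertex of `T`. -/
def plusRel {A : Type*} (r : A → A → Prop) : Option A → Option A → Prop :=
  fun x y => match x, y with
  | some a, some b => r a b
  | some _, none => True
  | _, _ => False

/-- Blowup of `r` by the family of tournaments `t`. -/
def blowupG {ι : Type*} [DecidableEq ι] (r : ι → ι → Prop) {κ : ι → Type*}
    (t : ∀ i, κ i → κ i → Prop) : (Σ i, κ i) → (Σ i, κ i) → Prop :=
  fun x y => if h : x.1 = y.1 then t y.1 (h ▸ x.2) y.2 else r x.1 y.1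

/-- Transitive `(a_1,…,a_n)`-blowup of `r`. -/
def blowup {ι : Type*} [DecidableEq ι] (r : ι → ι → Prop) (a : ι → ℕ) :
    (Σ i, Fin (a i)) → (Σ i, Fin (a i)) → Prop :=
  blowupG r (fun _ p q => p < q)

/-- Membership in `𝒟_k`: every subtournament has determinant at most `k²`. -/
def memD {V : Type*} [Fintype V] [DecidableEq V] (r : V → V → Prop) (k : ℕ) : Prop :=
  ∀ s : Finset V, subdet r s ≤ (k : ℤ) ^ 2

/-- Pfaffian-type orientation condition characterising diamonds. -/
def DiaCond {V : Type*} (r : V → V → Prop) (a b c d : V) : Prop :=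
  ((r a b ↔ r c d) ↔ (r a d ↔ r b c)) ∧ ((r a b ↔ r c d) ↔ ¬ (r a c ↔ r b d))

lemma diaCond_of_isDiamond {V : Type*} {r : V → V → Prop} (hT : IsTournament r)
    {a b c d : V} (hab : a ≠ b) (hac : a ≠ c) (had : a ≠ d) (hbc : b ≠ c) (hbd : b ≠ d)
    (hcd : c ≠ d) (h : IsDiamond r {a, b, c, d}) : DiaCond r a b c d := by
  obtain ⟨p, q, s, t, hX, hpq, hps, hpt, hqs, hqt, hst, h1, h2, h3, h4⟩ := h
  have key : DiaCond r p q s t := by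
    have e1 := hT.2 p q hpq
    have e2 := hT.2 p s hps
    have e3 := hT.2 p t hpt
    have e4 := hT.2 q s hqs
    have e5 := hT.2 q t hqt
    have e6 := hT.2 s t hst
    unfold DiaCond
    tauto
  have ha : a = p ∨ a = q ∨ a = s ∨ a = t := by
    rw [Finset.ext_iff] at hX; simpa using (hX a).1 (by simp)
  have hb : b = p ∨ b = q ∨ b = s ∨ b = t := by
    rw [Finset.ext_iff] at hX; simpa using (hX b).1 (by simp)
  have hc : c = p ∨ c = q ∨ c = s ∨ c = t := by
    rw [Finset.ext_iff] at hX; simpa using (hX c).1 (by simp)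
  have hd : d = p ∨ d = q ∨ d = s ∨ d = t := by
    rw [Finset.ext_iff] at hX; simpa using (hX d).1 (by simp)
  clear hX h1 h2 h3 h4
  have e1 := hT.2 p q hpq
  have e2 := hT.2 p s hps
  have e3 := hT.2 p t hpt
  have e4 := hT.2 q s hqs
  have e5 := hT.2 q t hqt
  have e6 := hT.2 s t hst
  unfold DiaCond at key ⊢
  rcases ha with rfl | rfl | rfl | rfl <;> rcases hb with rfl | rfl | rfl | rfl <;>
    first
    | exact absurd rfl hab
    | (rcases hc with rfl | rfl | rfl | rfl <;>
        first
        | exact absurd rfl hac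
        | exact absurd rfl hbc
        | (rcases hd with rfl | rfl | rfl | rfl <;>
            first
            | exact absurd rfl had
            | exact absurd rfl hbd
            | exact absurd rfl hcd
            | (clear hab hac had hbc hbd hcd hpq hps hpt hqs hqt hst; grind)))

set_option maxHeartbeats 2000000 in
/-- A diamond plus another vertex gives a second diamond. -/
lemma exists_other {V : Type*} {r : V → V → Prop} (hT : IsTournament r)
    {X : Finset V} (h : IsDiamond r X) {v : V} (hv : v ∉ X) :
    ∃ Y, IsDiamond r Y ∧ v ∈ Y ∧ ∀ y ∈ Y, y = v ∨ y ∈ X := by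
  obtain ⟨a, b, c, d, rfl, hab, hac, had, hbc, hbd, hcd, h1, h2, h3, h4⟩ := h
  simp only [Finset.mem_insert, Finset.mem_singleton, not_or] at hv
  obtain ⟨va, vb, vc, vd⟩ := hv
  have mk : ∀ p q s t : V, p ≠ q → p ≠ s → p ≠ t → q ≠ s → q ≠ t → s ≠ t →
      r q s → r s t → r t q → ((r p q ∧ r p s ∧ r p t) ∨ (r q p ∧ r s p ∧ r t p)) →
      (v = p ∨ v = q ∨ v = s ∨ v = t) →
      (({p, q, s, t} : Finset V) ⊆ insert v {a, b, c, d}) →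
      ∃ Y, IsDiamond r Y ∧ v ∈ Y ∧ ∀ y ∈ Y, y = v ∨ y ∈ ({a, b, c, d} : Finset V) := by
    intro p q s t g1 g2 g3 g4 g5 g6 k1 k2 k3 k4 k5 k6
    exact ⟨{p, q, s, t}, ⟨p, q, s, t, rfl, g1, g2, g3, g4, g5, g6, k1, k2, k3, k4⟩,
      by simpa using k5, fun y hy => Finset.mem_insert.1 (k6 hy)⟩
  have va' := hT.2 v a va
  have vb' := hT.2 v b vb
  have vc' := hT.2 v c vc
  have vd' := hT.2 v d vd
  by_contra hne
  have mk' : ∀ p q s t : V, p ≠ q → p ≠ s → p ≠ t → q ≠ s → q ≠ t → s ≠ t →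
      (v = p ∨ v = q ∨ v = s ∨ v = t) →
      (({p, q, s, t} : Finset V) ⊆ insert v {a, b, c, d}) →
      ¬ (r q s ∧ r s t ∧ r t q ∧ ((r p q ∧ r p s ∧ r p t) ∨ (r q p ∧ r s p ∧ r t p))) := by
    intro p q s t g1 g2 g3 g4 g5 g6 k5 k6 ⟨k1, k2, k3, k4⟩
    exact hne (mk p q s t g1 g2 g3 g4 g5 g6 k1 k2 k3 k4 k5 k6)
  clear mk hne
  have m1 := mk' v b c d vb vc vd hbc hbd hcd (by simp) (by intro x; simp; clear * -; tauto)
  have six : ∀ x y : V, x ≠ y → a ≠ x → a ≠ y → v ≠ x → v ≠ y →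
      (x = b ∨ x = c ∨ x = d) → (y = b ∨ y = c ∨ y = d) → r x y →
      ¬ (r y v ∧ r v x ∧ ((r a x ∧ r a y ∧ r a v) ∨ (r x a ∧ r y a ∧ r v a))) ∧
      ¬ (r y a ∧ r a x ∧ ((r v x ∧ r v y ∧ r v a) ∨ (r x v ∧ r y v ∧ r a v))) ∧
      ¬ (r y v ∧ r v a ∧ r a y ∧ ((r x y ∧ r x v ∧ r x a) ∨ (r y x ∧ r v x ∧ r a x))) ∧
      ¬ (r y a ∧ r a v ∧ r v y ∧ ((r x y ∧ r x v ∧ r x a) ∨ (r y x ∧ r v x ∧ r a x))) ∧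
      ¬ (r x v ∧ r v a ∧ r a x ∧ ((r y x ∧ r y v ∧ r y a) ∨ (r x y ∧ r v y ∧ r a y))) ∧
      ¬ (r x a ∧ r a v ∧ r v x ∧ ((r y x ∧ r y v ∧ r y a) ∨ (r x y ∧ r v y ∧ r a y))) := by
    intro x y hxy hax hay hvx hvy hx hy hr
    have sub : ∀ z, z = a ∨ z = v ∨ z = x ∨ z = y → z ∈ insert v ({a, b, c, d} : Finset V) := by
      intro z hz
      simp only [Finset.mem_insert, Finset.mem_singleton]
      clear * - hz hx hy
      rcases hz with h | h | h | h <;> subst h <;> tauto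
    have n1 := mk' a x y v hax hay (Ne.symm va) hxy hvx.symm hvy.symm (by simp)
      (by intro z hz; simp at hz; apply sub; clear * - hz; tauto)
    have n2 := mk' v x y a hvx hvy va hxy hax.symm hay.symm (by simp)
      (by intro z hz; simp at hz; apply sub; clear * - hz; tauto)
    have n3 := mk' x y v a hxy hvx.symm hax.symm hvy.symm hay.symm va (by simp)
      (by intro z hz; simp at hz; apply sub; clear * - hz; tauto)
    have n4 := mk' x y a v hxy hax.symm hvx.symm hay.symm hvy.symm (Ne.symm va) (by simp)
      (by intro z hz; simp at hz; apply sub; clear * - hz; tauto)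
    have n5 := mk' y x v a hxy.symm hvy.symm hay.symm hvx.symm hax.symm va (by simp)
      (by intro z hz; simp at hz; apply sub; clear * - hz; tauto)
    have n6 := mk' y x a v hxy.symm hay.symm hvy.symm hax.symm hvx.symm (Ne.symm va) (by simp)
      (by intro z hz; simp at hz; apply sub; clear * - hz; tauto)
    exact ⟨fun h => n1 ⟨hr, h⟩, fun h => n2 ⟨hr, h⟩, n3,
      by clear * - n4; tauto, n5, by clear * - n6; tauto⟩
  have x1 := six b c hbc hab hac vb vc (by simp) (by simp) h1
  have x2 := six c d hcd hac had vc vd (by simp) (by simp) h2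
  have x3 := six d b hbd.symm had hab vd vb (by simp) (by simp) h3
  have e1 := hT.2 a b hab
  have e2 := hT.2 a c hac
  have e3 := hT.2 a d had
  have e4 := hT.2 b c hbc
  have e5 := hT.2 b d hbd
  have e6 := hT.2 c d hcd
  clear six mk'
  clear hab hac had hbc hbd hcd va vb vc vd
  grind

lemma IsDiamond.card {V : Type*} {r : V → V → Prop} {X : Finset V}
    (h : IsDiamond r X) : X.card = 4 := by
  obtain ⟨a, b, c, d, rfl, hab, hac, had, hbc, hbd, hcd, -⟩ := h
  rw [Finset.card_eq_succ]
  refine ⟨a, {b, c, d}, by simp [*], ?_, Finset.card_eq_three.2 ⟨b, c, d, hbc, hbd, hcd, rfl⟩⟩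
  ext; simp

lemma no_three {V : Type*} {r : V → V → Prop} (hT : IsTournament r)
    {S X Y Z : Finset V} (hS : S.card = 5) (hX : IsDiamond r X) (hY : IsDiamond r Y)
    (hZ : IsDiamond r Z) (sX : X ⊆ S) (sY : Y ⊆ S) (sZ : Z ⊆ S) (hXY : X ≠ Y) (hXZ : X ≠ Z)
    (hYZ : Y ≠ Z) : False := by
  have er : ∀ W : Finset V, IsDiamond r W → W ⊆ S → ∃ w ∈ S, W = S.erase w := by
    intro W hW sW
    have h1 : (S \ W).card = 1 := by
      rw [Finset.card_sdiff_of_subset sW, hS, hW.card]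
    obtain ⟨w, hw⟩ := Finset.card_eq_one.1 h1
    refine ⟨w, ?_, ?_⟩
    · have : w ∈ S \ W := by simp [hw]
      exact (Finset.mem_sdiff.1 this).1
    · rw [← Finset.sdiff_singleton_eq_erase, ← hw, Finset.sdiff_sdiff_eq_self sW]
  obtain ⟨x, xS, rfl⟩ := er X hX sX
  obtain ⟨y, yS, rfl⟩ := er Y hY sY
  obtain ⟨z, zS, rfl⟩ := er Z hZ sZ
  have hxy : x ≠ y := fun h => hXY (by rw [h])
  have hxz : x ≠ z := fun h => hXZ (by rw [h])
  have hyz : y ≠ z := fun h => hYZ (by rw [h])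
  have h3 : ({x, y, z} : Finset V) ⊆ S := by
    intro t; simp; rintro (rfl | rfl | rfl) <;> assumption
  have h2 : (S \ {x, y, z}).card = 2 := by
    rw [Finset.card_sdiff_of_subset h3, hS, Finset.card_eq_three.2 ⟨x, y, z, hxy, hxz, hyz, rfl⟩]
  obtain ⟨u, w, huw, hd⟩ := Finset.card_eq_two.1 h2
  have hu : u ∈ S \ {x, y, z} := by simp [hd]
  have hw : w ∈ S \ {x, y, z} := by simp [hd]
  have hSe : S = {x, y, z, u, w} := by
    rw [← Finset.sdiff_union_of_subset h3, hd]
    ext t; simp; tauto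
  simp only [Finset.mem_sdiff, Finset.mem_insert, Finset.mem_singleton, not_or] at hu hw
  obtain ⟨-, ux, uy, uz⟩ := hu
  obtain ⟨-, wx, wy, wz⟩ := hw
  have eX : S.erase x = {y, z, u, w} := by rw [hSe]; ext t; simp; grind
  have eY : S.erase y = {x, z, u, w} := by rw [hSe]; ext t; simp; grind
  have eZ : S.erase z = {x, y, u, w} := by rw [hSe]; ext t; simp; grind
  rw [eX] at hX
  rw [eY] at hY
  rw [eZ] at hZ
  have dX := diaCond_of_isDiamond hT hyz (Ne.symm uy) (Ne.symm wy) (Ne.symm uz) (Ne.symm wz) huw hX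
  have dY := diaCond_of_isDiamond hT hxz (Ne.symm ux) (Ne.symm wx) (Ne.symm uz) (Ne.symm wz) huw hY
  have dZ := diaCond_of_isDiamond hT hxy (Ne.symm ux) (Ne.symm wx) (Ne.symm uy) (Ne.symm wy) huw hZ
  unfold DiaCond at dX dY dZ
  clear * - dX dY dZ
  grind

theorem stmt7 {V : Type*} [Fintype V] [DecidableEq V] (r : V → V → Prop)
    (hT : IsTournament r) (n : ℕ) (hn : 5 ≤ n) (hcard : Fintype.card V = n) :
    numDiamonds r = 0 ∨
      (n - 3 ≤ numDiamonds r ∧ 5 * numDiamonds r ≤ 2 * n.choose 4) := by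
  set D : Finset (Finset V) := Finset.univ.filter (fun X => IsDiamond r X) with hD
  have hnum : numDiamonds r = D.card := by
    unfold numDiamonds
    rw [← Set.ncard_coe_finset]
    congr 1
    ext X; simp [hD]
  have memD' : ∀ X, X ∈ D ↔ IsDiamond r X := by intro X; simp [hD]
  rw [hnum]
  rcases Finset.eq_empty_or_nonempty D with h0 | ⟨X, hX⟩
  · left; simp [h0]
  right
  constructor
  · have hX' := (memD' X).1 hX
    have ex : ∀ v : V, ∃ Y, v ∉ X → IsDiamond r Y ∧ v ∈ Y ∧ ∀ y ∈ Y, y = v ∨ y ∈ X := by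
      intro v
      by_cases hv : v ∈ X
      · exact ⟨∅, fun h => absurd hv h⟩
      · obtain ⟨Y, hY⟩ := exists_other hT hX' hv
        exact ⟨Y, fun _ => hY⟩
    choose f hf using ex
    have hle : (Xᶜ).card ≤ (D.erase X).card := by
      apply Finset.card_le_card_of_injOn f
      · intro v hv
        have hv : v ∉ X := by simpa using hv
        have h := hf v hv
        have h' : f v ≠ X := fun e => hv (e ▸ h.2.1)
        simp [memD', h.1, h']
      · intro v hv w hw e
        have hv : v ∉ X := by simpa using hv
        have hw : w ∉ X := by simpa using hw
        have h1 := (hf v hv).2.1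
        rw [e] at h1
        have h2 := (hf w hw).2.2 v h1
        exact h2.resolve_right hv
    rw [Finset.card_compl, hcard, hX'.card, Finset.card_erase_of_mem hX] at hle
    omega
  · have key := Finset.card_mul_le_card_mul (s := D)
      (t := Finset.powersetCard 5 (Finset.univ : Finset V))
      (fun X S => X ⊆ S) (m := n - 4) (n := 2) ?_ ?_
    · rw [Finset.card_powersetCard, Finset.card_univ, hcard] at key
      have hc := Nat.choose_succ_right_eq n 4
      have hpos : 0 < n - 4 := by omega
      refine Nat.le_of_mul_le_mul_right ?_ hpos
      calc 5 * D.card * (n - 4) = 5 * (D.card * (n - 4)) := by ring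
        _ ≤ 5 * (n.choose 5 * 2) := by gcongr
        _ = 2 * (n.choose 5 * 5) := by ring
        _ = 2 * (n.choose 4 * (n - 4)) := by rw [hc]
        _ = _ := by ring
    · intro Y hY
      have hY4 := ((memD' Y).1 hY).card
      have : (Yᶜ).card = n - 4 := by rw [Finset.card_compl, hcard, hY4]
      rw [← this]
      apply Finset.card_le_card_of_injOn (fun v => insert v Y)
      · intro v hv
        have hv : v ∉ Y := by simpa using hv
        simp [Finset.mem_powersetCard, hv, hY4]
      · intro v hv w hw e
        have hv : v ∉ Y := by simpa using hv
        have : v ∈ insert w Y := by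
          have e' : insert v Y = insert w Y := e
          rw [← e']; simp
        rw [Finset.mem_insert] at this
        exact this.resolve_right hv
    · intro S hS
      by_contra hlt
      push Not at hlt
      obtain ⟨A, B, C, hA, hB, hC, hAB, hAC, hBC⟩ := Finset.two_lt_card_iff.1 hlt
      rw [Finset.mem_bipartiteBelow, memD'] at hA hB hC
      exact no_three hT (Finset.mem_powersetCard.1 hS).2 hA.1 hB.1 hC.1 hA.2 hB.2 hC.2 hAB hAC hBC
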